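/- arXiv:1103.5500 — 2 statements merged into one kernel-verified Lean document; each statement's English description precedes it below -/
import Mathlib

section
/- For all i ∈ {1,…,n} and all positive integers d, one has R·t_i + R·σ_i^d(t_i) = R, i.e. the ideal of R generated by t_i and σ_i^d(t_i) is all of R. -/
namespace MTW

abbrev Exp (n : ℕ) : Type := (Fin n → ℤ) × (Fin n → ℤ)

abbrev LR (K : Type) [Field K] (n : ℕ) : Type := AddMonoidAlgebra K (Exp n)

noncomputable def mon (K : Type) [Field K] (n : ℕ) (d : Exp n) : LR K n :=
  AddMonoidAlgebra.single d 1

noncomputable def U (K : Type) [Field K] (n : ℕ) (j : Fin n) : LR K n :=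
  mon K n (Pi.single j 1, 0)

noncomputable def V (K : Type) [Field K] (n : ℕ) (j : Fin n) : LR K n :=
  mon K n (0, Pi.single j 1)

noncomputable def tElt (K : Type) [Field K] (n : ℕ) (k : ℤ) (r s : Fin n → Fin n → K)
    (i : Fin n) : LR K n :=
  (r i i ^ k - s i i ^ k)⁻¹ •
    (r i i ^ k • mon K n (Pi.single i k, 0) - s i i ^ k • mon K n (0, Pi.single i k))

noncomputable def sigmaZ (K : Type) [Field K] (n : ℕ)
    (σ : Fin n → (LR K n ≃ₐ[K] LR K n)) (g : Fin n → ℤ) : LR K n ≃ₐ[K] LR K n :=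
  (List.ofFn fun i => σ i ^ (g i)).prod

def IsInvariantIdeal (K : Type) [Field K] (n : ℕ)
    (σ : Fin n → (LR K n ≃ₐ[K] LR K n)) (J : Ideal (LR K n)) : Prop :=
  ∀ (g : Fin n → ℤ), ∀ x ∈ J, sigmaZ K n σ g x ∈ J

noncomputable def invariants (K : Type) [Field K] (n : ℕ)
    (σ : Fin n → (LR K n ≃ₐ[K] LR K n)) : Subalgebra K (LR K n) :=
  ⨅ i, AlgHom.equalizer (σ i).toAlgHom (AlgHom.id K (LR K n))

theorem mon_add (K : Type) [Field K] (n : ℕ) (d e : Exp n) :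
    mon K n (d + e) = mon K n d * mon K n e := by
  simp [mon, AddMonoidAlgebra.single_mul_single]

theorem mon_mul_mon_neg (K : Type) [Field K] (n : ℕ) (e : Exp n) :
    mon K n e * mon K n (-e) = 1 := by
  rw [← mon_add, add_neg_cancel]
  rfl

/-- An endomorphism scaling a monomial by `c` scales its `m`-th power by `c ^ m`. -/
theorem map_mon_zsmul {K : Type} [Field K] {n : ℕ} (f : LR K n ≃ₐ[K] LR K n) {e : Exp n}
    {c : K} (hc : c ≠ 0) (h : f (mon K n e) = c • mon K n e) (m : ℤ) :
    f (mon K n (m • e)) = c ^ m • mon K n (m • e) := by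
  have hneg : f (mon K n (-e)) = c⁻¹ • mon K n (-e) := by
    have h1 : c • mon K n e * f (mon K n (-e)) = 1 := by
      rw [← h, ← map_mul, mon_mul_mon_neg, map_one]
    have h2 : c • mon K n e * c⁻¹ • mon K n (-e) = 1 := by
      rw [smul_mul_smul_comm, mul_inv_cancel₀ hc, mon_mul_mon_neg, one_smul]
    exact (IsUnit.of_mul_eq_one _ h1).mul_left_cancel (h1.trans h2.symm)
  induction m with
  | zero =>
    rw [zero_smul, zpow_zero, one_smul]
    exact map_one f
  | succ m ih =>
    rw [add_smul, one_smul, mon_add, map_mul, ih, h, smul_mul_smul_comm, zpow_add_one₀ hc]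
  | pred m ih =>
    rw [sub_smul, one_smul, sub_eq_add_neg, mon_add, map_mul, ih, hneg, smul_mul_smul_comm,
      zpow_sub_one₀ hc]

theorem pow_apply_of_apply_eq_smul {K A : Type} [Field K] [Ring A] [Algebra K A]
    (f : A ≃ₐ[K] A) {x : A} {c : K} (h : f x = c • x) (d : ℕ) : (f ^ d) x = c ^ d • x := by
  induction d with
  | zero => simp
  | succ d ih => rw [pow_succ, AlgEquiv.mul_apply, h, map_smul, ih, smul_smul, pow_succ']

theorem zpow_ne_one_of_pow_ne_one {K : Type} [Field K] {q : K}
    (h : ∀ m : ℕ, 0 < m → q ^ m ≠ 1) {m : ℤ} (hm : m ≠ 0) : q ^ m ≠ 1 := by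
  intro hq
  refine h m.natAbs (Int.natAbs_pos.mpr hm) ?_
  rcases Int.natAbs_eq m with hm' | hm'
  · rwa [hm', zpow_natCast] at hq
  · rwa [hm', zpow_neg, zpow_natCast, inv_eq_one] at hq

/-- Two binomials in `X` and a unit `Y` with non-proportional coefficients are comaximal. -/
theorem span_pair_eq_top_of_det_ne_zero {K A : Type} [Field K] [CommRing A] [Algebra K A]
    {X Y : A} (hY : IsUnit Y) {a b a' b' : K} (hdet : a' * b - a * b' ≠ 0) :
    Ideal.span {a • X - b • Y, a' • X - b' • Y} = ⊤ := by
  have hmem : (a * b' - a' * b) • Y ∈ Ideal.span {a • X - b • Y, a' • X - b' • Y} := by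
    rw [Ideal.mem_span_pair]
    refine ⟨algebraMap K A a', -algebraMap K A a, ?_⟩
    simp only [Algebra.smul_def, map_sub, map_mul]
    ring
  refine Ideal.eq_top_of_isUnit_mem _ hmem ?_
  rw [Algebra.smul_def]
  refine IsUnit.mul (IsUnit.map _ (isUnit_iff_ne_zero.mpr fun h => hdet ?_)) hY
  linear_combination -h

/-- For all `i` and all positive integers `d`,
`R·t_i + R·σ_i^d(t_i) = R`. -/
theorem statement3
    (K : Type) [Field K] (n : ℕ) (hn : 0 < n)
    (k : ℤ) (hk : k ≠ 0) (r s : Fin n → Fin n → K)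
    (hr : ∀ i j, r i j ≠ 0) (hs : ∀ i j, s i j ≠ 0)
    (hroot : ∀ i, ∀ m : ℕ, 0 < m → (r i i / s i i) ^ m ≠ 1)
    (hrs : ∀ i j, i ≠ j → r i j ^ k = s i j ^ k)
    (σ : Fin n → (LR K n ≃ₐ[K] LR K n))
    (hσu : ∀ i j, σ i (U K n j) = (r i j)⁻¹ • U K n j)
    (hσv : ∀ i j, σ i (V K n j) = (s i j)⁻¹ • V K n j)
    (i : Fin n) (d : ℕ) (hd : 0 < d) :
    Ideal.span {tElt K n k r s i, ((σ i) ^ d) (tElt K n k r s i)} = ⊤ := by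
  have ha : r i i ^ k ≠ 0 := zpow_ne_zero _ (hr i i)
  have hb : s i i ^ k ≠ 0 := zpow_ne_zero _ (hs i i)
  have hq : r i i ^ k / s i i ^ k ≠ 1 := by
    rw [← div_zpow]
    exact zpow_ne_one_of_pow_ne_one (hroot i) hk
  have hqd : (r i i ^ k / s i i ^ k) ^ d ≠ 1 := by
    rw [← div_zpow, ← zpow_natCast, ← zpow_mul]
    exact zpow_ne_one_of_pow_ne_one (hroot i) (mul_ne_zero hk (by exact_mod_cast hd.ne'))
  have hX : σ i (mon K n (Pi.single i k, 0)) =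
      (r i i ^ k)⁻¹ • mon K n (Pi.single i k, 0) := by
    have := map_mon_zsmul (σ i) (inv_ne_zero (hr i i)) (hσu i i) k
    rwa [inv_zpow, Prod.smul_mk, smul_zero, ← Pi.single_smul, smul_eq_mul, mul_one] at this
  have hY : σ i (mon K n (0, Pi.single i k)) =
      (s i i ^ k)⁻¹ • mon K n (0, Pi.single i k) := by
    have := map_mon_zsmul (σ i) (inv_ne_zero (hs i i)) (hσv i i) k
    rwa [inv_zpow, Prod.smul_mk, smul_zero, ← Pi.single_smul, smul_eq_mul, mul_one] at this
  have hYunit : IsUnit (mon K n (0, Pi.single i k)) :=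
    IsUnit.of_mul_eq_one _ (mon_mul_mon_neg K n _)
  unfold tElt
  generalize mon K n (Pi.single i k, 0) = X at *
  generalize mon K n (0, Pi.single i k) = Y at *
  generalize r i i ^ k = a at *
  generalize s i i ^ k = b at *
  have hab : a - b ≠ 0 := fun h => hq (by rw [sub_eq_zero.mp h, div_self hb])
  simp only [map_smul, map_sub, pow_apply_of_apply_eq_smul (σ i) hX,
    pow_apply_of_apply_eq_smul (σ i) hY, smul_sub, smul_smul]
  refine span_pair_eq_top_of_det_ne_zero hYunit fun h => hqd ?_
  rw [div_pow, div_eq_one_iff_eq (pow_ne_zero _ hb)]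
  have h' : (a - b)⁻¹ ^ 2 * (a * b) * ((a ^ d)⁻¹ - (b ^ d)⁻¹) = 0 := by
    rw [← inv_pow, ← inv_pow]
    linear_combination h
  have hcoeff : (a - b)⁻¹ ^ 2 * (a * b) ≠ 0 :=
    mul_ne_zero (pow_ne_zero _ (inv_ne_zero hab)) (mul_ne_zero ha hb)
  exact inv_injective (sub_eq_zero.mp ((mul_eq_zero.mp h').resolve_left hcoeff))

end MTW
end

section
/- Assume that for each i ∈ {1,…,n}, the only pair (d,d') ∈ ℤ² with r_i^d s_i^{d'} = 1 is (d,d') = (0,0). Then the invariant subring R^{ℤ^n} consists exactly of the scalars, i.e. R^{ℤ^n} = K·1. -/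
namespace MTW

/-- The exponents `d` on whose monomial the algebra endomorphism `f` acts by the scalar `χ d`. -/
def eigenExponents {K G : Type*} [Field K] [AddCommGroup G]
    (f : AddMonoidAlgebra K G →ₐ[K] AddMonoidAlgebra K G) (χ : AddChar G K) : AddSubgroup G where
  carrier := {d | f (AddMonoidAlgebra.single d 1) = χ d • AddMonoidAlgebra.single d 1}
  zero_mem' := by
    simp [← AddMonoidAlgebra.one_def]
  add_mem' {a b} ha hb := by
    have hab : (AddMonoidAlgebra.single (a + b) 1 : AddMonoidAlgebra K G) =
        AddMonoidAlgebra.single a 1 * AddMonoidAlgebra.single b 1 := by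
      simp [AddMonoidAlgebra.single_mul_single]
    simp only [Set.mem_ofPred_eq] at ha hb ⊢
    rw [hab, map_mul, ha, hb, smul_mul_smul_comm, AddChar.map_add_eq_mul]
  neg_mem' {a} ha := by
    have hinv : (AddMonoidAlgebra.single a 1 : AddMonoidAlgebra K G) *
        AddMonoidAlgebra.single (-a) 1 = 1 := by
      simp [AddMonoidAlgebra.single_mul_single, AddMonoidAlgebra.one_def]
    have hχ : χ a * χ (-a) = 1 := by
      rw [← AddChar.map_add_eq_mul, add_neg_cancel, AddChar.map_zero_eq_one]
    simp only [Set.mem_ofPred_eq] at ha ⊢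
    refine left_inv_eq_right_inv (a := f (AddMonoidAlgebra.single a 1)) ?_ ?_
    · rw [mul_comm, ← map_mul, hinv, map_one]
    · rw [ha, smul_mul_smul_comm, hχ, hinv, one_smul]

/-- An endomorphism acting diagonally on monomials acts diagonally on coefficients. -/
theorem coeff_map_of_eigenExponents_eq_top {K G : Type*} [Field K] [AddCommGroup G]
    {f : AddMonoidAlgebra K G →ₐ[K] AddMonoidAlgebra K G} {χ : AddChar G K}
    (h : eigenExponents f χ = ⊤) (x : AddMonoidAlgebra K G) (d : G) :
    (f x).coeff d = χ d * x.coeff d := by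
  induction x using AddMonoidAlgebra.induction_linear with
  | zero => simp
  | add x y hx hy => simp [hx, hy, mul_add]
  | single m a =>
    have hm : f (AddMonoidAlgebra.single m 1) = χ m • AddMonoidAlgebra.single m 1 :=
      (h ▸ AddSubgroup.mem_top m : m ∈ eigenExponents f χ)
    have hsingle : (AddMonoidAlgebra.single m a : AddMonoidAlgebra K G) =
        a • AddMonoidAlgebra.single m 1 := by simp [AddMonoidAlgebra.smul_single]
    rw [hsingle, map_smul, hm]
    by_cases hmd : m = d
    · subst hmd
      simp [mul_comm]
    · simp [hmd]

/-- A subgroup of `Exp n` containing all exponents of the variables is everything. -/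
theorem eq_top_of_single_mem {n : ℕ} {H : AddSubgroup (Exp n)}
    (hu : ∀ j, ((Pi.single j 1, 0) : Exp n) ∈ H) (hv : ∀ j, ((0, Pi.single j 1) : Exp n) ∈ H) :
    H = ⊤ := by
  refine (AddSubgroup.eq_top_iff' H).2 fun d => ?_
  have hd : d = ∑ j, d.1 j • ((Pi.single j 1, 0) : Exp n) +
      ∑ j, d.2 j • ((0, Pi.single j 1) : Exp n) := by
    ext j <;> simp [Prod.fst_sum, Prod.snd_sum, Finset.sum_apply, Pi.single_apply]
  rw [hd]
  exact add_mem (sum_mem fun j _ => zsmul_mem (hu j) _) (sum_mem fun j _ => zsmul_mem (hv j) _)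

/-- The character `d ↦ a ^ (-d.1 i) * b ^ (-d.2 i)` of the exponent group. -/
def weight {K : Type*} [Field K] {n : ℕ} (i : Fin n) {a b : K} (ha : a ≠ 0) (hb : b ≠ 0) :
    AddChar (Exp n) K where
  toFun d := a ^ (-d.1 i) * b ^ (-d.2 i)
  map_zero_eq_one' := by simp
  map_add_eq_mul' d e := by
    simp only [Prod.fst_add, Prod.snd_add, Pi.add_apply, neg_add, zpow_add₀ ha, zpow_add₀ hb]
    ring

theorem weight_apply {K : Type*} [Field K] {n : ℕ} (i : Fin n) {a b : K} (ha : a ≠ 0)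
    (hb : b ≠ 0) (d : Exp n) : weight i ha hb d = a ^ (-d.1 i) * b ^ (-d.2 i) :=
  rfl

/-- In the diagonal (multiparameter Weyl algebra) setting
`σ_i(u_j) = r_i^{-δ_{ij}} u_j`, `σ_i(v_j) = s_i^{-δ_{ij}} v_j`: if for each `i` the only
pair `(d,d') ∈ ℤ²` with `r_i^d s_i^{d'} = 1` is `(0,0)`, then `R^{ℤ^n} = K·1`. -/
theorem statement14
    (K : Type) [Field K] (n : ℕ)
    (r s : Fin n → K) (hr : ∀ i, r i ≠ 0) (hs : ∀ i, s i ≠ 0)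
    (σ : Fin n → (LR K n ≃ₐ[K] LR K n))
    (hσu : ∀ i j, σ i (U K n j) = (if i = j then (r i)⁻¹ else 1) • U K n j)
    (hσv : ∀ i j, σ i (V K n j) = (if i = j then (s i)⁻¹ else 1) • V K n j)
    (hgen : ∀ i : Fin n, ∀ d d' : ℤ, r i ^ d * s i ^ d' = 1 → d = 0 ∧ d' = 0) :
    invariants K n σ = ⊥ := by
  have hdiag : ∀ i, eigenExponents (σ i).toAlgHom (weight i (hr i) (hs i)) = ⊤ := fun i => by
    refine eq_top_of_single_mem (fun j => (hσu i j).trans ?_) (fun j => (hσv i j).trans ?_)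
    all_goals
      by_cases hij : i = j
      · subst hij
        simp [weight_apply, U, V, mon]
      · simp [weight_apply, U, V, mon, hij]
  refine eq_bot_iff.2 fun x hx => ?_
  have hfix : ∀ i, (σ i).toAlgHom x = x := fun i => (Algebra.mem_iInf.1 hx) i
  have hsupp : ∀ d, d ≠ 0 → x.coeff d = 0 := by
    intro d hd
    by_contra hxd
    have hexp : ∀ i, d.1 i = 0 ∧ d.2 i = 0 := fun i => by
      have hcoeff := coeff_map_of_eigenExponents_eq_top (hdiag i) x d
      rw [hfix i, eq_comm, mul_eq_right₀ hxd, weight_apply] at hcoeff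
      simpa using hgen i _ _ hcoeff
    exact hd (Prod.ext (funext fun i => (hexp i).1) (funext fun i => (hexp i).2))
  refine Algebra.mem_bot.2 ⟨x.coeff 0, ?_⟩
  ext d
  by_cases hd : d = 0
  · simp [hd]
  · simp [hsupp d hd, hd]

end MTW
end
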